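/- arXiv:2411.02626 — 2 statements merged into one kernel-verified Lean document; each statement's English description precedes it below -/
import Mathlib

section
/- Let ν ≥ 3, β > 0 and α ≥ 0. Define Θ_α on Schwartz functions f : ℝ^ν → ℂ by Θ_α(f) := exp(−(1/2)·[ (1/β)∫_{ℝ^ν} |𝓕f(ξ)|²/(2π²|ξ|²) dξ + 2^ν·α·|∫_{ℝ^ν} f(x) dx|² ]). Then for all Schwartz f, g : ℝ^ν → ℂ, the real function t ↦ Θ_α(f + g + t·(i·(−(1/2)Δf))) is differentiable at t = 0 and β · (d/dt)|_{t=0} Θ_α(f + g + t·(i·(−(1/2)Δf))) = Im⟨g, f⟩_{L²} · Θ_α(f + g), independently of the value of α. (This is the weak (δ₀⁰,β)-KMS condition for the classical condensate state ω_0^{α,0}, for the derivation δ₀⁰(W⁰(f)) = i·Φ₀(iHf)·W⁰(f) with H = −Δ/2.) -/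
open MeasureTheory
open scoped FourierTransform

/-- The characteristic functional of the classical condensate state `ω_0^{α,0}`:
`Θ_α(φ) = exp(−(1/2)[(1/β)∫|𝓕φ(ξ)|²/(2π²|ξ|²) dξ + 2^ν α |∫φ|²])`. -/
noncomputable def Theta (ν : ℕ) (β α : ℝ)
    (φ : EuclideanSpace ℝ (Fin ν) → ℂ) : ℝ :=
  Real.exp (-(1 / 2) *
    ((1 / β) * (∫ ξ : EuclideanSpace ℝ (Fin ν), ‖𝓕 φ ξ‖ ^ 2 / (2 * Real.pi ^ 2 * ‖ξ‖ ^ 2)) +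
      2 ^ ν * α * ‖∫ x, φ x‖ ^ 2))

/-- The Laplacian `Δφ(x) = Σ_i ∂²φ/∂x_i²(x)`. -/
noncomputable def lap (ν : ℕ) (φ : EuclideanSpace ℝ (Fin ν) → ℂ)
    (x : EuclideanSpace ℝ (Fin ν)) : ℂ :=
  ∑ i : Fin ν, iteratedFDeriv ℝ 2 φ x (fun _ => EuclideanSpace.single i 1)

open SchwartzMap Laplacian ComplexConjugate

section Schwartz

variable {E : Type*} [NormedAddCommGroup E] [InnerProductSpace ℝ E] [FiniteDimensional ℝ E]
  [MeasurableSpace E] [BorelSpace E]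

/-- The Fourier transform turns the Laplacian into multiplication by `-(2π)²‖ξ‖²`. -/
theorem SchwartzMap.fourier_laplacian_apply (f : 𝓢(E, ℂ)) (ξ : E) :
    𝓕 (Δ f) ξ = -(2 * Real.pi) ^ 2 * ‖ξ‖ ^ 2 * 𝓕 f ξ := by
  have h : (fun x : E => ‖x‖ ^ 2).HasTemperateGrowth := by fun_prop
  rw [laplacian_eq_fourierMultiplierCLM, FourierTransform.fourier_smul,
    fourierMultiplierCLM_apply, FourierTransform.fourier_fourierInv_eq, smul_apply]
  change _ • smulLeftCLM ℂ (fun x : E => ‖x‖ ^ 2) (𝓕 f) ξ = _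
  rw [smulLeftCLM_apply_apply h]
  simp only [Complex.real_smul]
  push_cast
  ring

theorem SchwartzMap.integral_laplacian (f : 𝓢(E, ℂ)) : ∫ x, Δ f x = 0 := by
  have h := fourier_laplacian_apply f 0
  rw [fourier_coe, Real.fourier_eq] at h
  simpa using h

theorem SchwartzMap.integrable_conj_mul (φ ψ : 𝓢(E, ℂ)) :
    Integrable (fun x => conj (φ x) * ψ x) :=
  (φ.memLp 2).star.integrable_mul (ψ.memLp 2)

/-- In dimension at least three, `‖φ‖² / ‖ξ‖²` is integrable for Schwartz `φ`. -/
theorem SchwartzMap.integrable_norm_sq_div_norm_sq (hd : 3 ≤ Module.finrank ℝ E) (φ : 𝓢(E, ℂ)) :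
    Integrable (fun ξ => ‖φ ξ‖ ^ 2 / ‖ξ‖ ^ 2) := by
  have hmeas : AEStronglyMeasurable (fun ξ => ‖φ ξ‖ ^ 2 / ‖ξ‖ ^ 2) :=
    ((φ.continuous.norm.pow 2).measurable.div (by fun_prop)).aestronglyMeasurable
  have hball : IntegrableOn (fun ξ => ‖φ ξ‖ ^ 2 / ‖ξ‖ ^ 2) (Metric.ball 0 1) := by
    refine integrableOn_ball_of_norm_le_rpow (C := (SchwartzMap.seminorm ℝ 0 0 φ) ^ 2) (α := 2)
      (by lia) (by exact_mod_cast (by lia : 2 < Module.finrank ℝ E)) ?_ hmeas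
    filter_upwards with ξ
    rw [Real.norm_of_nonneg (by positivity), Real.rpow_neg (norm_nonneg _), Real.rpow_two,
      ← div_eq_mul_inv]
    gcongr
    exact φ.norm_le_seminorm ℝ ξ
  have hcompl : IntegrableOn (fun ξ => ‖φ ξ‖ ^ 2 / ‖ξ‖ ^ 2) (Metric.ball 0 1)ᶜ := by
    refine Integrable.mono'
      ((φ.memLp 2 volume).integrable_norm_pow (p := 2) (by norm_num)).integrableOn
      hmeas.restrict ?_
    filter_upwards [ae_restrict_mem Metric.isOpen_ball.measurableSet.compl] with ξ hξ
    have h1 : 1 ≤ ‖ξ‖ := by simpa using hξ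
    rw [Real.norm_of_nonneg (by positivity)]
    exact div_le_self (by positivity) (one_le_pow₀ h1)
  simpa using hball.union hcompl

/-- Along `u + t (i(-Δ/2)f)` the quadratic form with Fourier density `1 / (2π²‖ξ‖²)` is a
quadratic polynomial in `t` with linear coefficient `-2 Im ⟨u, f⟩`. -/
theorem SchwartzMap.integral_fourier_norm_sq_div_add_smul (hd : 3 ≤ Module.finrank ℝ E)
    {u v f : 𝓢(E, ℂ)}
    (hv : ∀ ξ, 𝓕 v ξ = Complex.I * (2 * Real.pi ^ 2 * ‖ξ‖ ^ 2 * 𝓕 f ξ)) (t : ℝ) :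
    ∫ ξ, ‖𝓕 (u + t • v) ξ‖ ^ 2 / (2 * Real.pi ^ 2 * ‖ξ‖ ^ 2) =
      (∫ ξ, ‖𝓕 u ξ‖ ^ 2 / (2 * Real.pi ^ 2 * ‖ξ‖ ^ 2)) +
        t * (-2 * (∫ x, conj (u x) * f x).im) +
        t ^ 2 * ∫ ξ, ‖𝓕 v ξ‖ ^ 2 / (2 * Real.pi ^ 2 * ‖ξ‖ ^ 2) := by
  have : Nontrivial E := Module.nontrivial_of_finrank_pos (R := ℝ) (by lia)
  have hint (φ : 𝓢(E, ℂ)) : Integrable (fun ξ => ‖φ ξ‖ ^ 2 / (2 * Real.pi ^ 2 * ‖ξ‖ ^ 2)) := by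
    simpa only [div_div, mul_comm] using
      (integrable_norm_sq_div_norm_sq hd φ).div_const (Real.pi ^ 2 * 2)
  have hcross : ∫ ξ, (conj (𝓕 u ξ) * 𝓕 f ξ).im = (∫ x, conj (u x) * f x).im := by
    have hpl := integral_inner_fourier_fourier u f
    simp only [RCLike.inner_apply'] at hpl
    rw [← hpl]
    exact integral_im (integrable_conj_mul _ _)
  have him : Integrable (fun ξ => t * (-2 * (conj (𝓕 u ξ) * 𝓕 f ξ).im)) :=
    ((integrable_conj_mul _ _).im.const_mul _).const_mul _
  rw [← hcross, ← integral_const_mul, ← integral_const_mul, ← integral_const_mul,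
    ← integral_add (hint _) him, ← integral_add ((hint _).fun_add him) ((hint _).const_mul _)]
  refine integral_congr_ae ?_
  filter_upwards [Measure.ae_ne volume (0 : E)] with ξ hξ
  have hξ' : ‖ξ‖ ≠ 0 := norm_ne_zero_iff.mpr hξ
  rw [FourierTransform.fourier_add, FourierTransform.fourier_smul, add_apply, smul_apply, hv]
  generalize 𝓕 u ξ = a
  generalize 𝓕 f ξ = b
  generalize ‖ξ‖ = r at *
  have hw : ((2 * Real.pi ^ 2 * r ^ 2 : ℝ) : ℂ) = 2 * Real.pi ^ 2 * r ^ 2 := by push_cast; rfl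
  have hw0 : 2 * Real.pi ^ 2 * r ^ 2 ≠ 0 := by positivity
  rw [← hw]
  generalize 2 * Real.pi ^ 2 * r ^ 2 = w at *
  simp only [Complex.sq_norm, Complex.normSq_apply]
  simp
  field_simp
  ring

end Schwartz

theorem lap_eq_laplacian (ν : ℕ) (f : 𝓢(EuclideanSpace ℝ (Fin ν), ℂ)) : lap ν f = Δ f := by
  ext x
  rw [laplacian_apply, InnerProductSpace.laplacian_eq_iteratedFDeriv_orthonormalBasis f
    (EuclideanSpace.basisFun (Fin ν) ℝ), lap]
  refine Finset.sum_congr rfl fun i _ => congrArg _ ?_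
  ext j
  fin_cases j <;> simp

/-- The weak `(δ₀⁰,β)`-KMS condition for the classical condensate state `ω_0^{α,0}`: for all
Schwartz `f, g`, `β·(d/dt)|₀ Θ_α(f + g + t·(i·(−(1/2)Δf))) = Im⟨g,f⟩_{L²}·Θ_α(f+g)`,
independently of the value of `α`. -/
theorem stmt14 (ν : ℕ) (hν : 3 ≤ ν) (β : ℝ) (hβ : 0 < β) (α : ℝ) (hα : 0 ≤ α)
    (f g : SchwartzMap (EuclideanSpace ℝ (Fin ν)) ℂ) :
    DifferentiableAt ℝ
      (fun t : ℝ => Theta ν β α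
        (fun x => f x + g x + t • (Complex.I * (-(1 / 2) * lap ν (⇑f) x)))) 0 ∧
    β * deriv
        (fun t : ℝ => Theta ν β α
          (fun x => f x + g x + t • (Complex.I * (-(1 / 2) * lap ν (⇑f) x)))) 0
      = (∫ x, (starRingEnd ℂ) (g x) * f x).im * Theta ν β α (fun x => f x + g x) := by
  set v : 𝓢(EuclideanSpace ℝ (Fin ν), ℂ) := (Complex.I * -(1 / 2)) • Δ f with hv
  have hfun (t : ℝ) : (fun x => f x + g x + t • (Complex.I * (-(1 / 2) * lap ν (⇑f) x))) =
      ⇑(f + g + t • v) := by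
    ext x
    simp [hv, lap_eq_laplacian, mul_assoc]
  have hd : 3 ≤ Module.finrank ℝ (EuclideanSpace ℝ (Fin ν)) := by simpa using hν
  have hvF (ξ : EuclideanSpace ℝ (Fin ν)) :
      𝓕 v ξ = Complex.I * (2 * Real.pi ^ 2 * ‖ξ‖ ^ 2 * 𝓕 f ξ) := by
    rw [hv, FourierTransform.fourier_smul, smul_apply, fourier_laplacian_apply, smul_eq_mul]
    ring
  have hv0 : ∫ x, v x = 0 := by
    simp only [hv, smul_apply, integral_const_mul, smul_eq_mul, integral_laplacian, mul_zero]
  have hu (t : ℝ) : ∫ x, (f + g + t • v) x = ∫ x, (f + g) x := by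
    simp only [add_apply (f + g), smul_apply]
    rw [integral_add (f + g).integrable (v.integrable.fun_smul t), integral_smul, hv0, smul_zero,
      add_zero]
  have hIm : (∫ x, conj ((f + g) x) * f x).im = (∫ x, conj (g x) * f x).im := by
    have hff : (∫ x, conj (f x) * f x).im = 0 := by
      simp_rw [← Complex.normSq_eq_conj_mul_self]
      rw [integral_complex_ofReal, Complex.ofReal_im]
    simp only [add_apply, map_add, add_mul]
    rw [integral_add (integrable_conj_mul f f) (integrable_conj_mul g f), Complex.add_im, hff, zero_add]
  have hTheta (t : ℝ) :
      Theta ν β α (fun x => f x + g x + t • (Complex.I * (-(1 / 2) * lap ν (⇑f) x))) =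
        Real.exp (-(1 / 2) * ((1 / β) *
          ((∫ ξ, ‖𝓕 (f + g) ξ‖ ^ 2 / (2 * Real.pi ^ 2 * ‖ξ‖ ^ 2)) +
            t * (-2 * (∫ x, conj (g x) * f x).im) +
            t ^ 2 * ∫ ξ, ‖𝓕 v ξ‖ ^ 2 / (2 * Real.pi ^ 2 * ‖ξ‖ ^ 2)) +
          2 ^ ν * α * ‖∫ x, (f + g) x‖ ^ 2)) := by
    rw [hfun, Theta, hu, ← fourier_coe, integral_fourier_norm_sq_div_add_smul hd hvF, hIm]
  have hTheta0 : Theta ν β α (fun x => f x + g x) = Real.exp (-(1 / 2) * ((1 / β) *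
      (∫ ξ, ‖𝓕 (f + g) ξ‖ ^ 2 / (2 * Real.pi ^ 2 * ‖ξ‖ ^ 2)) +
        2 ^ ν * α * ‖∫ x, (f + g) x‖ ^ 2)) := by
    simpa using hTheta 0
  have hderiv : HasDerivAt
      (fun t : ℝ => Theta ν β α
        (fun x => f x + g x + t • (Complex.I * (-(1 / 2) * lap ν (⇑f) x))))
      ((∫ x, conj (g x) * f x).im / β * Theta ν β α (fun x => f x + g x)) 0 := by
    rw [hTheta0, funext hTheta]
    generalize (∫ ξ, ‖𝓕 (f + g) ξ‖ ^ 2 / (2 * Real.pi ^ 2 * ‖ξ‖ ^ 2)) = A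
    generalize (∫ ξ, ‖𝓕 v ξ‖ ^ 2 / (2 * Real.pi ^ 2 * ‖ξ‖ ^ 2)) = C
    generalize (∫ x, conj (g x) * f x).im = B
    generalize 2 ^ ν * α * ‖∫ x, (f + g) x‖ ^ 2 = D
    have h := ((((((hasDerivAt_id' (0 : ℝ)).mul_const (-2 * B)).const_add A).fun_add
      (((hasDerivAt_id' (0 : ℝ)).fun_pow 2).mul_const C)).const_mul (1 / β)).add_const D).const_mul
        (-(1 / 2)) |>.exp
    convert h using 1
    ring_nf
  refine ⟨hderiv.differentiableAt, ?_⟩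
  rw [hderiv.deriv]
  field_simp
end

section
/- Let ν ≥ 1, β > 0, α ∈ [0,∞), and f ∈ L¹(ℝ^ν, ℂ). Let (μ_L)_{L>0} be real numbers with μ_L < E_0(L) = νπ²/(8L²) for every L > 0 and lim_{L→∞} 1/((2L)^ν · β · (E_0(L) − μ_L)) = α. Then lim_{L→∞} |⟨ψ_{0,L}, f⟩|² / (E_0(L) − μ_L) = 2^ν · β · α · |∫_{ℝ^ν} f(x) dx|², where ψ_{0,L} := ψ_{(1,…,1),L} is the Dirichlet ground state of the box Λ_L. -/
open MeasureTheory Filter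

/-- The L²-normalized Dirichlet eigenfunction `ψ_{n,L}` of `−Δ/2` on the box `Λ_L = [−L,L]^ν`,
extended by `0` outside the box. -/
noncomputable def psiBox (ν : ℕ) (n : Fin ν → ℕ) (L : ℝ)
    (x : EuclideanSpace ℝ (Fin ν)) : ℝ :=
  if ∀ i, |x i| ≤ L then
    L ^ (-(ν : ℝ) / 2) * ∏ i, Real.sin (Real.pi * (n i) * (x i - L) / (2 * L))
  else 0

/-- The box ground state without its normalizing factor `L ^ (-ν / 2)`. -/
noncomputable def groundProfile (ν : ℕ) (L : ℝ) (x : EuclideanSpace ℝ (Fin ν)) : ℝ :=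
  if ∀ i, |x i| ≤ L then ∏ i, Real.sin (Real.pi * (x i - L) / (2 * L)) else 0

lemma psiBox_one_eq (ν : ℕ) (L : ℝ) (x : EuclideanSpace ℝ (Fin ν)) :
    psiBox ν (fun _ => 1) L x = L ^ (-(ν : ℝ) / 2) * groundProfile ν L x := by
  simp [psiBox, groundProfile]

lemma abs_groundProfile_le_one (ν : ℕ) (L : ℝ) (x : EuclideanSpace ℝ (Fin ν)) :
    |groundProfile ν L x| ≤ 1 := by
  unfold groundProfile
  split_ifs
  · rw [Finset.abs_prod]
    exact Finset.prod_le_one (fun _ _ => abs_nonneg _) fun _ _ => Real.abs_sin_le_one _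
  · simp

lemma measurable_groundProfile (ν : ℕ) (L : ℝ) : Measurable (groundProfile ν L) := by
  unfold groundProfile
  refine Measurable.ite ?_ ?_ measurable_const
  · refine IsClosed.measurableSet ?_
    simp only [Set.ofPred_forall]
    exact isClosed_iInter fun i => isClosed_le (by fun_prop) continuous_const
  · exact Continuous.measurable (by fun_prop)

lemma tendsto_groundProfile (ν : ℕ) (x : EuclideanSpace ℝ (Fin ν)) :
    Tendsto (fun L => groundProfile ν L x) atTop (nhds ((-1) ^ ν)) := by
  have hfactor (i : Fin ν) :
      Tendsto (fun L : ℝ => Real.sin (Real.pi * (x i - L) / (2 * L))) atTop (nhds (-1)) := by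
    have harg : Tendsto (fun L : ℝ => Real.pi * x i / 2 * L⁻¹ - Real.pi / 2) atTop
        (nhds (Real.pi * x i / 2 * 0 - Real.pi / 2)) :=
      (tendsto_inv_atTop_zero.const_mul _).sub_const _
    have hsin := (Real.continuous_sin.tendsto _).comp harg
    have hval : Real.sin (Real.pi * x i / 2 * 0 - Real.pi / 2) = -1 := by simp
    rw [hval] at hsin
    refine hsin.congr' ?_
    filter_upwards [eventually_gt_atTop 0] with L hL
    simp only [Function.comp_apply]
    congr 1
    field_simp
  have hprod := tendsto_finsetProd Finset.univ fun i _ => hfactor i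
  simp only [Finset.prod_const, Finset.card_univ, Fintype.card_fin] at hprod
  refine hprod.congr' ?_
  have hbox : ∀ᶠ L : ℝ in atTop, ∀ i, |x i| ≤ L :=
    eventually_all.2 fun i => eventually_ge_atTop _
  filter_upwards [hbox] with L hL
  simp [groundProfile, hL]

lemma tendsto_integral_groundProfile_mul (ν : ℕ) (f : EuclideanSpace ℝ (Fin ν) → ℂ)
    (hf : Integrable f) :
    Tendsto (fun L : ℝ => ∫ x, ((groundProfile ν L x : ℝ) : ℂ) * f x) atTop
      (nhds ((-1) ^ ν * ∫ x, f x)) := by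
  rw [← integral_const_mul]
  refine tendsto_integral_filter_of_dominated_convergence (fun x => ‖f x‖) ?_ ?_ hf.norm ?_
  · refine .of_forall fun L => ?_
    exact (Complex.measurable_ofReal.comp
      (measurable_groundProfile ν L)).aestronglyMeasurable.mul hf.aestronglyMeasurable
  · refine .of_forall fun L => .of_forall fun x => ?_
    rw [norm_mul, Complex.norm_real, Real.norm_eq_abs]
    exact mul_le_of_le_one_left (norm_nonneg _) (abs_groundProfile_le_one ν L x)
  · refine .of_forall fun x => Tendsto.mul_const _ ?_
    simpa [Function.comp_def] using
      (Complex.continuous_ofReal.tendsto _).comp (tendsto_groundProfile ν x)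

lemma sq_norm_integral_psiBox_one (ν : ℕ) (f : EuclideanSpace ℝ (Fin ν) → ℂ) {L : ℝ}
    (hL : 0 < L) :
    ‖∫ x, ((psiBox ν (fun _ => 1) L x : ℝ) : ℂ) * f x‖ ^ 2 =
      (L ^ ν)⁻¹ * ‖∫ x, ((groundProfile ν L x : ℝ) : ℂ) * f x‖ ^ 2 := by
  simp only [psiBox_one_eq, Complex.ofReal_mul, mul_assoc]
  rw [integral_const_mul, norm_mul, Complex.norm_real, Real.norm_eq_abs, mul_pow, sq_abs,
    ← Real.rpow_mul_natCast hL.le]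
  congr 1
  rw [Nat.cast_ofNat, div_mul_cancel₀ _ two_ne_zero, Real.rpow_neg hL.le, Real.rpow_natCast]

/-- The macroscopic ground-state (condensate) contribution in the classical thermodynamic
limit: if `μ_L < E_0(L) = νπ²/(8L²)` and `1/((2L)^ν·β·(E_0(L) − μ_L)) → α`, then
`|⟨ψ_{0,L}, f⟩|²/(E_0(L) − μ_L) → 2^ν·β·α·|∫f|²`. -/
theorem stmt15 (ν : ℕ) (hν : 1 ≤ ν) (β α : ℝ) (hβ : 0 < β) (hα : 0 ≤ α)
    (f : EuclideanSpace ℝ (Fin ν) → ℂ) (hf : Integrable f)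
    (μ : ℝ → ℝ) (hμ : ∀ L : ℝ, 0 < L → μ L < ν * Real.pi ^ 2 / (8 * L ^ 2))
    (hlim : Tendsto
      (fun L : ℝ => 1 / ((2 * L) ^ ν * β * (ν * Real.pi ^ 2 / (8 * L ^ 2) - μ L)))
      atTop (nhds α)) :
    Tendsto (fun L : ℝ =>
        ‖∫ x, ((psiBox ν (fun _ => 1) L x : ℝ) : ℂ) * f x‖ ^ 2 /
          (ν * Real.pi ^ 2 / (8 * L ^ 2) - μ L))
      atTop (nhds (2 ^ ν * β * α * ‖∫ x, f x‖ ^ 2)) := by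
  have hnorm := ((tendsto_integral_groundProfile_mul ν f hf).norm.pow 2)
  rw [norm_mul, norm_pow, norm_neg, norm_one, one_pow, one_mul] at hnorm
  refine ((hlim.const_mul (2 ^ ν * β)).mul hnorm).congr' ?_
  filter_upwards [eventually_gt_atTop 0] with L hL
  have hgap := (sub_pos.2 (hμ L hL)).ne'
  rw [sq_norm_integral_psiBox_one ν f hL]
  generalize (ν * Real.pi ^ 2 / (8 * L ^ 2) - μ L) = gap at hgap ⊢
  rw [mul_pow]
  field_simp
end
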